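/- Every linear automorphism of L_{2,4} whose 6×6 matrix has only real non-negative entries is a positive scalar multiple of the edge permutation matrix induced by a vertex relabeling of K_4; in particular, up to positive scale there are exactly 24 such non-negative linear automorphisms, and they form a subgroup acting by relabeling the vertices of K_4. -/

import Mathlib

/-- Edges of the complete graph `K_n`: unordered pairs of distinct vertices.
There are `N = C(n,2)` of them, and they index the coordinates of `ℂ^N`. -/
abbrev Edge (n : ℕ) : Type := {e : Sym2 (Fin n) // ¬ e.IsDiag}

/-- Complex squared length along an edge: `m_ij(p) = Σ_k (p_i^k − p_j^k)²`
(complex squares, no conjugation). -/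
noncomputable def cSqLen {n d : ℕ} (p : Fin n → Fin d → ℂ) : Sym2 (Fin n) → ℂ :=
  Sym2.lift ⟨fun i j => ∑ k, (p i k - p j k) ^ 2,
    fun i j => Finset.sum_congr rfl fun k _ => by ring⟩

/-- The squared measurement variety `M_{d,n}`: the image of the squared
measurement map over all complex configurations of `n` points in ℂ^d. -/
def Mvar (d n : ℕ) : Set (Edge n → ℂ) :=
  {w | ∃ p : Fin n → Fin d → ℂ, ∀ e : Edge n, w e = cSqLen p e.val}

/-- The coordinate-wise squaring map `s`. -/
def sqMap {n : ℕ} (w : Edge n → ℂ) : Edge n → ℂ := fun e => w e ^ 2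

/-- The unsquared measurement variety `L_{d,n} = s⁻¹(M_{d,n})`. -/
def Lvar (d n : ℕ) : Set (Edge n → ℂ) := sqMap ⁻¹' Mvar d n

/-- The `6 × 6` matrix of the edge permutation of `K_4` induced by the vertex
relabeling `σ`, scaled by the real factor `c`. -/
noncomputable def relabelMat (σ : Equiv.Perm (Fin 4)) (c : ℝ) :
    Matrix (Edge 4) (Edge 4) ℂ :=
  Matrix.of fun e f : Edge 4 =>
    if (e : Sym2 (Fin 4)) = Sym2.map σ (f : Sym2 (Fin 4)) then (c : ℂ) else 0


def ed : Fin 6 → Edge 4 := ![⟨s(0,1), by decide⟩, ⟨s(0,2), by decide⟩, ⟨s(0,3), by decide⟩,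
  ⟨s(2,3), by decide⟩, ⟨s(1,3), by decide⟩, ⟨s(1,2), by decide⟩]

lemma ed_bij : Function.Bijective ed := by decide

lemma perm_edge : ∀ σ : Equiv.Perm (Fin 4),
    (∀ f : Edge 4, Sym2.map σ f.1 = f.1) → σ = 1 := by decide

/-- Cayley-Menger polynomial in squared lengths. -/
def CM {R : Type*} [CommRing R] (A B C D E F : R) : R :=
  A*D*(B+E+C+F-A-D)+B*E*(A+D+C+F-B-E)+C*F*(A+D+B+E-C-F)-A*B*F-A*E*C-B*C*D-D*E*F

def FF {R : Type*} [CommRing R] (x : Fin 6 → R) : R :=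
  CM (x 0^2) (x 1^2) (x 2^2) (x 3^2) (x 4^2) (x 5^2)

lemma FF_map {R S : Type*} [CommRing R] [CommRing S] (φ : R →+* S) (x : Fin 6 → R) :
    φ (FF x) = FF (fun i => φ (x i)) := by
  simp [FF, CM]

lemma csqrt (z : ℂ) : ∃ w : ℂ, w ^ 2 = z := IsAlgClosed.exists_pow_nat_eq z (by norm_num)

/-- Gram factorization when one diagonal entry is nonzero -/
lemma gram1 (A B C x y z : ℂ) (hA : A ≠ 0)
    (h : A*B*C + 2*x*y*z - A*z^2 - B*y^2 - C*x^2 = 0) :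
    ∃ p1 p2 q1 q2 r1 r2 : ℂ, p1^2+p2^2 = A ∧ q1^2+q2^2 = B ∧ r1^2+r2^2 = C ∧
      p1*q1+p2*q2 = x ∧ p1*r1+p2*r2 = y ∧ q1*r1+q2*r2 = z := by
  obtain ⟨a, ha⟩ := csqrt A
  have ha0 : a ≠ 0 := by rintro rfl; apply hA; rw [← ha]; norm_num
  obtain ⟨b, hb⟩ := csqrt (B - (x/a)^2)
  obtain ⟨c, hc⟩ := csqrt (C - (y/a)^2)
  have key : (b*c)^2 = (z - x*y/A)^2 := by
    rw [mul_pow, hb, hc, ← ha]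
    rw [← ha] at h
    field_simp
    linear_combination a^2 * h
  rcases sq_eq_sq_iff_eq_or_eq_neg.1 key with hk | hk
  · refine ⟨a, 0, x/a, b, y/a, c, by simpa using ha, by rw [hb]; ring, by rw [hc]; ring, ?_, ?_, ?_⟩
    · field_simp; ring
    · field_simp; ring
    · rw [hk, ← ha]; field_simp; ring
  · refine ⟨a, 0, x/a, b, y/a, -c, by simpa using ha, by rw [hb]; ring,
      by rw [neg_sq, hc]; ring, ?_, ?_, ?_⟩
    · field_simp; ring
    · field_simp; ring
    · rw [mul_neg, hk, ← ha]; field_simp; ring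

lemma gram0 (x y : ℂ) :
    ∃ p1 p2 q1 q2 r1 r2 : ℂ, p1^2+p2^2 = 0 ∧ q1^2+q2^2 = 0 ∧ r1^2+r2^2 = 0 ∧
      p1*q1+p2*q2 = 0 ∧ p1*r1+p2*r2 = x ∧ q1*r1+q2*r2 = y := by
  have hI := Complex.I_sq
  refine ⟨x, x*Complex.I, y, y*Complex.I, 1/2, -Complex.I/2, ?_, ?_, ?_, ?_, ?_, ?_⟩
  · linear_combination x^2*hI
  · linear_combination y^2*hI
  · linear_combination 1/4*hI
  · linear_combination x*y*hI
  · linear_combination -x/2*hI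
  · linear_combination -y/2*hI

lemma gram (A B C x y z : ℂ)
    (h : A*B*C + 2*x*y*z - A*z^2 - B*y^2 - C*x^2 = 0) :
    ∃ p1 p2 q1 q2 r1 r2 : ℂ, p1^2+p2^2 = A ∧ q1^2+q2^2 = B ∧ r1^2+r2^2 = C ∧
      p1*q1+p2*q2 = x ∧ p1*r1+p2*r2 = y ∧ q1*r1+q2*r2 = z := by
  by_cases hA : A = 0
  swap
  · exact gram1 A B C x y z hA h
  by_cases hB : B = 0
  swap
  · obtain ⟨p1, p2, q1, q2, r1, r2, h1, h2, h3, h4, h5, h6⟩ :=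
      gram1 B A C x z y hB (by linear_combination h)
    exact ⟨q1, q2, p1, p2, r1, r2, h2, h1, h3, by rw [← h4]; ring, h6, h5⟩
  by_cases hC : C = 0
  swap
  · obtain ⟨p1, p2, q1, q2, r1, r2, h1, h2, h3, h4, h5, h6⟩ :=
      gram1 C B A z y x hC (by linear_combination h)
    exact ⟨r1, r2, q1, q2, p1, p2, h3, h2, h1, by rw [← h6]; ring, by rw [← h5]; ring,
      by rw [← h4]; ring⟩
  subst hA hB hC
  have h' : x*y*z = 0 := by linear_combination h/2
  rcases mul_eq_zero.1 h' with h' | hz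
  · rcases mul_eq_zero.1 h' with hx | hy
    · subst hx; exact gram0 y z
    · subst hy
      obtain ⟨p1, p2, q1, q2, r1, r2, h1, h2, h3, h4, h5, h6⟩ := gram0 x z
      exact ⟨p1, p2, r1, r2, q1, q2, h1, h3, h2, h5, h4, by rw [← h6]; ring⟩
  · subst hz
    obtain ⟨p1, p2, q1, q2, r1, r2, h1, h2, h3, h4, h5, h6⟩ := gram0 x y
    exact ⟨r1, r2, p1, p2, q1, q2, h3, h1, h2, by rw [← h5]; ring, by rw [← h6]; ring, h4⟩

lemma mem_Lvar_iff (x : Edge 4 → ℂ) : x ∈ Lvar 2 4 ↔ FF (fun i => x (ed i)) = 0 := by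
  constructor
  · rintro ⟨p, hp⟩
    simp only [sqMap] at hp
    simp only [FF, hp]
    simp [ed, cSqLen, CM, Fin.sum_univ_two]
    ring
  · intro h
    set A := x (ed 0)^2 with hA
    set B := x (ed 1)^2 with hB
    set C := x (ed 2)^2 with hC
    set D := x (ed 3)^2 with hD
    set E := x (ed 4)^2 with hE
    set F := x (ed 5)^2 with hF
    have h' : CM A B C D E F = 0 := h
    obtain ⟨p1, p2, q1, q2, r1, r2, h1, h2, h3, h4, h5, h6⟩ :=
      gram A B C ((A+B-F)/2) ((A+C-E)/2) ((B+C-D)/2) (by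
        unfold CM at h'
        linear_combination h'/4)
    refine ⟨![![0,0], ![p1,p2], ![q1,q2], ![r1,r2]], ?_⟩
    intro e
    obtain ⟨i, rfl⟩ := ed_bij.2 e
    simp only [sqMap]
    fin_cases i
    · change A = _
      simp [ed, cSqLen, Fin.sum_univ_two]
      linear_combination -h1
    · change B = _
      simp [ed, cSqLen, Fin.sum_univ_two]
      linear_combination -h2
    · change C = _
      simp [ed, cSqLen, Fin.sum_univ_two]
      linear_combination -h3
    · change D = _
      simp [ed, cSqLen, Fin.sum_univ_two]
      linear_combination -h2-h3+2*h6
    · change E = _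
      simp [ed, cSqLen, Fin.sum_univ_two]
      linear_combination -h1-h3+2*h5
    · change F = _
      simp [ed, cSqLen, Fin.sum_univ_two]
      linear_combination -h1-h2+2*h4

open MvPolynomial in
lemma FF_homog (l : Fin 6 → MvPolynomial (Fin 6) ℂ) (hl : ∀ i, (l i).IsHomogeneous 1) :
    (FF l).IsHomogeneous 6 := by
  have h2 : ∀ i, (l i ^ 2).IsHomogeneous 2 := fun i => (hl i).pow 2
  have a := fun i j : Fin 6 => (h2 i).mul (h2 j)
  have t := fun i j k : Fin 6 => (a i j).mul (h2 k)
  simp only [FF, CM]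
  refine IsHomogeneous.sub (IsHomogeneous.sub (IsHomogeneous.sub (IsHomogeneous.sub
    (IsHomogeneous.add (IsHomogeneous.add ?_ ?_) ?_) ?_) ?_) ?_) ?_
  · exact (a 0 3).mul (((((h2 1).add (h2 4)).add (h2 2)).add (h2 5)).sub (h2 0) |>.sub (h2 3))
  · exact (a 1 4).mul (((((h2 0).add (h2 3)).add (h2 2)).add (h2 5)).sub (h2 1) |>.sub (h2 4))
  · exact (a 2 5).mul (((((h2 0).add (h2 3)).add (h2 1)).add (h2 4)).sub (h2 2) |>.sub (h2 5))
  · exact t 0 1 5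
  · exact t 0 4 2
  · exact t 1 2 3
  · exact t 3 4 5

open Polynomial in
noncomputable def fline : ℂ[X] := X^6+8*X^5-6*X^4-192*X^3-736*X^2-1152*X-640

open Polynomial in
lemma fline_squarefree : Squarefree fline := by
  apply Polynomial.Separable.squarefree
  refine ⟨C (1/23040000) * (220606848+135468832*X+20404760*X^2-8933544*X^3-1732122*X^4),
    C (1/23040000) * (-122579360-139238128*X-48543008*X^2-4559042*X^3+1873840*X^4+288687*X^5), ?_⟩
  have hd : derivative fline = 6*X^5+40*X^4-24*X^3-576*X^2-1472*X-1152 := by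
    simp only [fline, derivative_sub, derivative_add, derivative_mul, derivative_X_pow, derivative_X,
      derivative_ofNat]
    simp [show (C 6 : ℂ[X]) = 6 from rfl, show (C 5 : ℂ[X]) = 5 from rfl,
      show (C 4 : ℂ[X]) = 4 from rfl, show (C 3 : ℂ[X]) = 3 from rfl, show (C 2 : ℂ[X]) = 2 from rfl]
    ring
  rw [hd, fline]
  have hc : (C (1/23040000) : ℂ[X]) * 23040000 = 1 := by
    rw [show (23040000 : ℂ[X]) = C 23040000 from rfl, ← C_mul]
    norm_num
  linear_combination hc

open Polynomial in
lemma fline_natDegree : fline.natDegree = 6 := by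
  unfold fline
  compute_degree!

noncomputable def Fp : MvPolynomial (Fin 6) ℂ := FF MvPolynomial.X

open Polynomial in
noncomputable def lineHom : MvPolynomial (Fin 6) ℂ →ₐ[ℂ] ℂ[X] :=
  MvPolynomial.aeval ![X, X+1, X+3, X, X+1, X+3]

open Polynomial in
lemma lineHom_Fp : lineHom Fp = C 2 * fline := by
  have := FF_map (lineHom : MvPolynomial (Fin 6) ℂ →+* ℂ[X]) MvPolynomial.X
  rw [Fp]
  refine this.trans ?_
  simp [lineHom, FF, CM, fline]
  rw [show (C 2 : ℂ[X]) = 2 from rfl]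
  ring

lemma lineHom_le (P : MvPolynomial (Fin 6) ℂ) : (lineHom P).natDegree ≤ P.totalDegree := by
  have := MvPolynomial.aeval_natDegree_le (n := 1) P le_rfl
    (![.X, .X+1, .X+3, .X, .X+1, .X+3] : Fin 6 → Polynomial ℂ) (by
      intro i
      fin_cases i <;> simp <;> compute_degree)
  simpa [lineHom] using this

lemma lineHom_Fp_deg : (lineHom Fp).natDegree = 6 := by
  rw [lineHom_Fp, Polynomial.natDegree_C_mul (by norm_num), fline_natDegree]

lemma Fp_ne : Fp ≠ 0 := by
  intro h
  have := lineHom_Fp_deg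
  rw [h] at this
  simp at this

lemma Fp_deg : Fp.totalDegree = 6 :=
  (FF_homog _ fun i => MvPolynomial.isHomogeneous_X _ i).totalDegree Fp_ne

lemma Fp_squarefree : Squarefree Fp := by
  intro P ⟨Q, hPQ⟩
  have hne := Fp_ne
  have hP : P ≠ 0 := by rintro rfl; simp at hPQ; exact hne hPQ
  have hQ : Q ≠ 0 := by rintro rfl; simp at hPQ; exact hne hPQ
  have hsq : Squarefree (lineHom Fp) := by
    rw [lineHom_Fp]
    have : Associated fline (Polynomial.C 2 * fline) := by
      rw [mul_comm]
      exact associated_mul_unit_right _ _ (Polynomial.isUnit_C.2 (by norm_num))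
    exact (this.squarefree_iff).1 fline_squarefree
  have hu : IsUnit (lineHom P) := hsq _ ⟨lineHom Q, by rw [hPQ]; simp⟩
  have h0 : (lineHom P).natDegree = 0 := Polynomial.natDegree_eq_zero_of_isUnit hu
  have h1 : (lineHom Fp).natDegree ≤ Q.totalDegree := by
    rw [hPQ, map_mul, map_mul]
    refine (Polynomial.natDegree_mul_le).trans ?_
    have := Polynomial.natDegree_mul_le (p := lineHom P) (q := lineHom P)
    have := lineHom_le Q
    omega
  have h2 := Fp_deg
  rw [hPQ, MvPolynomial.totalDegree_mul_of_isDomain (mul_ne_zero hP hP) hQ,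
    MvPolynomial.totalDegree_mul_of_isDomain hP hP] at h2
  rw [lineHom_Fp_deg] at h1
  have h3 : P.totalDegree = 0 := by omega
  rw [MvPolynomial.totalDegree_eq_zero_iff_eq_C] at h3
  rw [h3] at hP ⊢
  exact (isUnit_iff_ne_zero.2 (fun h => hP (by rw [h]; simp))).map MvPolynomial.C

lemma eval_Fp (x : Fin 6 → ℂ) : MvPolynomial.eval x Fp = FF x := by
  rw [Fp, FF_map]; simp

lemma prop_of_zero (M : Matrix (Fin 6) (Fin 6) ℂ)
    (h : ∀ x : Fin 6 → ℂ, FF x = 0 → FF (M.mulVec x) = 0) :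
    ∃ c : ℂ, ∀ x, FF (M.mulVec x) = c * FF x := by
  let l : Fin 6 → MvPolynomial (Fin 6) ℂ := fun i => ∑ j, MvPolynomial.C (M i j) * MvPolynomial.X j
  have hl : ∀ i, (l i).IsHomogeneous 1 := fun i =>
    MvPolynomial.IsHomogeneous.sum _ _ _ fun j _ => MvPolynomial.isHomogeneous_C_mul_X _ _
  have hG : ∀ x, MvPolynomial.eval x (FF l) = FF (M.mulVec x) := by
    intro x
    rw [FF_map]
    congr 1
    funext i
    simp [l, Matrix.mulVec, dotProduct]
  have hrad : FF l ∈ (Ideal.span {Fp}).radical := by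
    rw [← MvPolynomial.vanishingIdeal_zeroLocus_eq_radical (K := ℂ),
      MvPolynomial.mem_vanishingIdeal_iff]
    intro x hx
    rw [MvPolynomial.zeroLocus_span] at hx
    have hx' := hx Fp rfl
    rw [MvPolynomial.aeval_eq_eval] at hx' ⊢
    change MvPolynomial.eval x Fp = 0 at hx'
    change MvPolynomial.eval x (FF l) = 0
    rw [eval_Fp] at hx'
    rw [hG]
    exact h x hx'
  obtain ⟨n, hn⟩ := hrad
  rw [Ideal.mem_span_singleton] at hn
  have hdvd : Fp ∣ FF l := by
    rcases eq_or_ne n 0 with rfl | h0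
    · rw [pow_zero] at hn
      exact hn.trans (one_dvd _)
    · exact (Fp_squarefree.dvd_pow_iff_dvd h0).1 hn
  obtain ⟨H, hH⟩ := hdvd
  by_cases hH0 : H = 0
  · refine ⟨0, fun x => ?_⟩
    rw [← hG, hH, hH0]; simp
  have hd : (FF l).totalDegree ≤ 6 := (FF_homog l hl).totalDegree_le
  rw [hH, MvPolynomial.totalDegree_mul_of_isDomain Fp_ne hH0, Fp_deg] at hd
  have h3 : H.totalDegree = 0 := by omega
  rw [MvPolynomial.totalDegree_eq_zero_iff_eq_C] at h3
  refine ⟨MvPolynomial.coeff 0 H, fun x => ?_⟩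
  rw [← hG, hH, map_mul, eval_Fp, h3]
  simp
  ring

def PP (v : Fin 6 → ℝ) : Prop :=
  ∃ (k : ℝ) (w : (Fin 6 → ℝ) →ₗ[ℝ] ℝ) (w' : (Fin 6 → ℝ) → ℝ), k ≠ 0 ∧ w ≠ 0 ∧
    ∀ y, ∃ β γ : ℝ, ∀ s : ℝ,
      FF (s • v + y) = -k * (w y)^2 * (s + w' y)^4 + β * (s + w' y)^2 + γ

lemma coef6 (p6 p5 p4 p3 p2 p1 p0 : ℝ)
    (h : ∀ s : ℝ, p6*s^6+p5*s^5+p4*s^4+p3*s^3+p2*s^2+p1*s+p0 = 0) :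
    p6 = 0 ∧ p5 = 0 ∧ p4 = 0 ∧ p3 = 0 := by
  have h0 := h 0
  have h1 := h 1
  have h2 := h (-1)
  have h3 := h 2
  have h4 := h (-2)
  have h5 := h 3
  have h6 := h (-3)
  norm_num at h0 h1 h2 h3 h4 h5 h6
  refine ⟨?_, ?_, ?_, ?_⟩ <;> linarith

lemma coefP (K u β γ p6 p5 p4 p3 p2 p1 p0 : ℝ)
    (h : ∀ s : ℝ, p6*s^6+p5*s^5+p4*s^4+p3*s^3+p2*s^2+p1*s+p0 =
      -K*(s+u)^4 + β*(s+u)^2+γ) :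
    p6 = 0 ∧ p5 = 0 ∧ p4 = -K ∧ p3 = -4*K*u := by
  obtain ⟨h1, h2, h3, h4⟩ := coef6 p6 p5 (p4+K) (p3+4*K*u) (p2+6*K*u^2-β)
    (p1+4*K*u^3-2*β*u) (p0+K*u^4-β*u^2-γ) (fun s => by linear_combination h s)
  exact ⟨h1, h2, by linarith, by linarith⟩

def T5 (a b c d e f a' b' c' d' e' f' : ℝ) : ℝ :=
  2*a*(d^2*(b^2+e^2+c^2+f^2-2*a^2-d^2)+(b^2-c^2)*(e^2-f^2))*a'
  + 2*b*(e^2*(a^2+d^2+c^2+f^2-2*b^2-e^2)+(a^2-c^2)*(d^2-f^2))*b'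
  + 2*c*(f^2*(a^2+d^2+b^2+e^2-2*c^2-f^2)+(a^2-b^2)*(d^2-e^2))*c'
  + 2*d*(a^2*(b^2+e^2+c^2+f^2-2*d^2-a^2)+(b^2-f^2)*(e^2-c^2))*d'
  + 2*e*(b^2*(a^2+d^2+c^2+f^2-2*e^2-b^2)+(a^2-f^2)*(d^2-c^2))*e'
  + 2*f*(c^2*(a^2+d^2+b^2+e^2-2*f^2-c^2)+(a^2-e^2)*(d^2-b^2))*f'

def T4 (a b c d e f a' b' c' d' e' f' : ℝ) : ℝ :=
  ((d^2*(b^2+e^2+c^2+f^2-2*a^2-d^2)+(b^2-c^2)*(e^2-f^2))-4*a^2*d^2)*a'^2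
  + ((e^2*(a^2+d^2+c^2+f^2-2*b^2-e^2)+(a^2-c^2)*(d^2-f^2))-4*b^2*e^2)*b'^2
  + ((f^2*(a^2+d^2+b^2+e^2-2*c^2-f^2)+(a^2-b^2)*(d^2-e^2))-4*c^2*f^2)*c'^2
  + ((a^2*(b^2+e^2+c^2+f^2-2*d^2-a^2)+(b^2-f^2)*(e^2-c^2))-4*d^2*a^2)*d'^2
  + ((b^2*(a^2+d^2+c^2+f^2-2*e^2-b^2)+(a^2-f^2)*(d^2-c^2))-4*e^2*b^2)*e'^2
  + ((c^2*(a^2+d^2+b^2+e^2-2*f^2-c^2)+(a^2-e^2)*(d^2-b^2))-4*f^2*c^2)*f'^2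
  + 4*a*b*(d^2+e^2-f^2)*a'*b'
  + 4*a*c*(d^2+f^2-e^2)*a'*c'
  + 4*a*d*(b^2+c^2+e^2+f^2-2*a^2-2*d^2)*a'*d'
  + 4*a*e*(d^2+b^2-c^2)*a'*e'
  + 4*a*f*(d^2+c^2-b^2)*a'*f'
  + 4*b*c*(e^2+f^2-d^2)*b'*c'
  + 4*b*d*(e^2+a^2-c^2)*b'*d'
  + 4*b*e*(a^2+c^2+d^2+f^2-2*b^2-2*e^2)*b'*e'
  + 4*b*f*(e^2+c^2-a^2)*b'*f'
  + 4*c*d*(f^2+a^2-b^2)*c'*d'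
  + 4*c*e*(f^2+b^2-a^2)*c'*e'
  + 4*c*f*(a^2+b^2+d^2+e^2-2*c^2-2*f^2)*c'*f'
  + 4*d*e*(a^2+b^2-f^2)*d'*e'
  + 4*d*f*(a^2+c^2-e^2)*d'*f'
  + 4*e*f*(b^2+c^2-d^2)*e'*f'

def T3 (a b c d e f a' b' c' d' e' f' : ℝ) : ℝ :=
  FF ![a+a',b+b',c+c',d+d',e+e',f+f'] - FF ![a,b,c,d,e,f] - T5 a b c d e f a' b' c' d' e' f' - T4 a b c d e f a' b' c' d' e' f'
    - T4 a' b' c' d' e' f' a b c d e f - T5 a' b' c' d' e' f' a b c d e f - FF ![a',b',c',d',e',f']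

set_option maxHeartbeats 4000000 in
lemma expandF (a b c d e f a' b' c' d' e' f' : ℝ) (s : ℝ) :
    FF (s • ![a,b,c,d,e,f] + ![a',b',c',d',e',f']) = FF ![a,b,c,d,e,f] * s^6 + T5 a b c d e f a' b' c' d' e' f' * s^5
     + T4 a b c d e f a' b' c' d' e' f' * s^4 + T3 a b c d e f a' b' c' d' e' f' * s^3
     + T4 a' b' c' d' e' f' a b c d e f * s^2 + T5 a' b' c' d' e' f' a b c d e f * s + FF ![a',b',c',d',e',f'] := by
  simp only [FF, CM, T3, T4, T5, Pi.add_apply, Pi.smul_apply, smul_eq_mul, Matrix.cons_val]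
  ring

structure HH (a b c d e f k : ℝ) (w : Fin 6 → ℝ) : Prop where
  hk : k ≠ 0
  hw : ∃ i, w i ≠ 0
  gA : a*(d^2*(b^2+e^2+c^2+f^2-2*a^2-d^2)+(b^2-c^2)*(e^2-f^2)) = 0
  gB : b*(e^2*(a^2+d^2+c^2+f^2-2*b^2-e^2)+(a^2-c^2)*(d^2-f^2)) = 0
  gC : c*(f^2*(a^2+d^2+b^2+e^2-2*c^2-f^2)+(a^2-b^2)*(d^2-e^2)) = 0
  gD : d*(a^2*(b^2+e^2+c^2+f^2-2*d^2-a^2)+(b^2-f^2)*(e^2-c^2)) = 0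
  gE : e*(b^2*(a^2+d^2+c^2+f^2-2*e^2-b^2)+(a^2-f^2)*(d^2-c^2)) = 0
  gF : f*(c^2*(a^2+d^2+b^2+e^2-2*f^2-c^2)+(a^2-e^2)*(d^2-b^2)) = 0
  qA : (d^2*(b^2+e^2+c^2+f^2-2*a^2-d^2)+(b^2-c^2)*(e^2-f^2))-4*a^2*d^2 = -k*w 0^2
  qB : (e^2*(a^2+d^2+c^2+f^2-2*b^2-e^2)+(a^2-c^2)*(d^2-f^2))-4*b^2*e^2 = -k*w 1^2
  qC : (f^2*(a^2+d^2+b^2+e^2-2*c^2-f^2)+(a^2-b^2)*(d^2-e^2))-4*c^2*f^2 = -k*w 2^2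
  qD : (a^2*(b^2+e^2+c^2+f^2-2*d^2-a^2)+(b^2-f^2)*(e^2-c^2))-4*d^2*a^2 = -k*w 3^2
  qE : (b^2*(a^2+d^2+c^2+f^2-2*e^2-b^2)+(a^2-f^2)*(d^2-c^2))-4*e^2*b^2 = -k*w 4^2
  qF : (c^2*(a^2+d^2+b^2+e^2-2*f^2-c^2)+(a^2-e^2)*(d^2-b^2))-4*f^2*c^2 = -k*w 5^2
  qAB : 2*a*b*(d^2+e^2-f^2) = -k*w 0*w 1
  qAC : 2*a*c*(d^2+f^2-e^2) = -k*w 0*w 2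
  qAD : 2*a*d*(b^2+c^2+e^2+f^2-2*a^2-2*d^2) = -k*w 0*w 3
  qAE : 2*a*e*(d^2+b^2-c^2) = -k*w 0*w 4
  qAF : 2*a*f*(d^2+c^2-b^2) = -k*w 0*w 5
  qBC : 2*b*c*(e^2+f^2-d^2) = -k*w 1*w 2
  qBD : 2*b*d*(e^2+a^2-c^2) = -k*w 1*w 3
  qBE : 2*b*e*(a^2+c^2+d^2+f^2-2*b^2-2*e^2) = -k*w 1*w 4
  qBF : 2*b*f*(e^2+c^2-a^2) = -k*w 1*w 5
  qCD : 2*c*d*(f^2+a^2-b^2) = -k*w 2*w 3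
  qCE : 2*c*e*(f^2+b^2-a^2) = -k*w 2*w 4
  qCF : 2*c*f*(a^2+b^2+d^2+e^2-2*c^2-2*f^2) = -k*w 2*w 5
  qDE : 2*d*e*(a^2+b^2-f^2) = -k*w 3*w 4
  qDF : 2*d*f*(a^2+c^2-e^2) = -k*w 3*w 5
  qEF : 2*e*f*(b^2+c^2-d^2) = -k*w 4*w 5
  cub : ∀ (y : Fin 6 → ℝ) (p6 p5 p4 p3 p2 p1 p0 : ℝ),
    (∀ s : ℝ, FF (s • ![a,b,c,d,e,f] + y) = p6*s^6+p5*s^5+p4*s^4+p3*s^3+p2*s^2+p1*s+p0) →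
    p4 = 0 → p3 = 0

lemma PP.hh {a b c d e f : ℝ} (h : PP ![a,b,c,d,e,f]) : ∃ k w, HH a b c d e f k w := by
  obtain ⟨k, w, w', hk, hw, H⟩ := h
  have H2 : ∀ (y : Fin 6 → ℝ) (p6 p5 p4 p3 p2 p1 p0 : ℝ),
    (∀ s : ℝ, FF (s • ![a,b,c,d,e,f] + y) = p6*s^6+p5*s^5+p4*s^4+p3*s^3+p2*s^2+p1*s+p0) →
    p6 = 0 ∧ p5 = 0 ∧ p4 = -(k * (w y)^2) ∧ p3 = -4*(k * (w y)^2) * w' y := by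
    intro y p6 p5 p4 p3 p2 p1 p0 hp
    obtain ⟨β, γ, hy⟩ := H y
    exact coefP _ _ β γ _ _ _ _ p2 p1 p0 (fun s => by rw [← hp, hy]; ring)
  have H3 : ∀  a' b' c' d' e' f' : ℝ, T5 a b c d e f a' b' c' d' e' f' = 0 ∧
     T4 a b c d e f a' b' c' d' e' f' = -k * (a' * w (Pi.single 0 1) + b' * w (Pi.single 1 1)
      + c' * w (Pi.single 2 1) + d' * w (Pi.single 3 1) + e' * w (Pi.single 4 1)
      + f' * w (Pi.single 5 1))^2 := by
    intro a' b' c' d' e' f'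
    obtain ⟨-, h5, h4, -⟩ := H2 _ _ _ _ _ _ _ _ (expandF a b c d e f a' b' c' d' e' f')
    refine ⟨h5, ?_⟩
    rw [h4]
    have : w ![a',b',c',d',e',f'] = a' * w (Pi.single 0 1) + b' * w (Pi.single 1 1)
      + c' * w (Pi.single 2 1) + d' * w (Pi.single 3 1) + e' * w (Pi.single 4 1)
      + f' * w (Pi.single 5 1) := by
      simp only [← smul_eq_mul, ← map_smul, ← map_add]
      congr 1
      funext i
      fin_cases i <;> simp
    rw [this]; ring
  refine ⟨k, fun i => w (Pi.single i 1), hk, ?_, ?_, ?_, ?_, ?_, ?_, ?_, ?_, ?_, ?_, ?_, ?_, ?_, ?_, ?_, ?_, ?_, ?_, ?_, ?_, ?_, ?_, ?_, ?_, ?_, ?_, ?_, ?_, ?_⟩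
  · by_contra hcon
    push Not at hcon
    apply hw
    apply LinearMap.pi_ext'
    intro i
    ext
    simpa using hcon i
  · have := (H3 1 0 0 0 0 0).1
    simp only [T5] at this
    linear_combination this/2
  · have := (H3 0 1 0 0 0 0).1
    simp only [T5] at this
    linear_combination this/2
  · have := (H3 0 0 1 0 0 0).1
    simp only [T5] at this
    linear_combination this/2
  · have := (H3 0 0 0 1 0 0).1
    simp only [T5] at this
    linear_combination this/2
  · have := (H3 0 0 0 0 1 0).1
    simp only [T5] at this
    linear_combination this/2
  · have := (H3 0 0 0 0 0 1).1
    simp only [T5] at this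
    linear_combination this/2
  · have := (H3 1 0 0 0 0 0).2
    simp only [T4] at this
    linear_combination this
  · have := (H3 0 1 0 0 0 0).2
    simp only [T4] at this
    linear_combination this
  · have := (H3 0 0 1 0 0 0).2
    simp only [T4] at this
    linear_combination this
  · have := (H3 0 0 0 1 0 0).2
    simp only [T4] at this
    linear_combination this
  · have := (H3 0 0 0 0 1 0).2
    simp only [T4] at this
    linear_combination this
  · have := (H3 0 0 0 0 0 1).2
    simp only [T4] at this
    linear_combination this
  · have h1 := (H3 1 1 0 0 0 0).2
    have h2 := (H3 1 0 0 0 0 0).2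
    have h3 := (H3 0 1 0 0 0 0).2
    simp only [T4] at h1 h2 h3
    linear_combination (h1-h2-h3)/2
  · have h1 := (H3 1 0 1 0 0 0).2
    have h2 := (H3 1 0 0 0 0 0).2
    have h3 := (H3 0 0 1 0 0 0).2
    simp only [T4] at h1 h2 h3
    linear_combination (h1-h2-h3)/2
  · have h1 := (H3 1 0 0 1 0 0).2
    have h2 := (H3 1 0 0 0 0 0).2
    have h3 := (H3 0 0 0 1 0 0).2
    simp only [T4] at h1 h2 h3
    linear_combination (h1-h2-h3)/2
  · have h1 := (H3 1 0 0 0 1 0).2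
    have h2 := (H3 1 0 0 0 0 0).2
    have h3 := (H3 0 0 0 0 1 0).2
    simp only [T4] at h1 h2 h3
    linear_combination (h1-h2-h3)/2
  · have h1 := (H3 1 0 0 0 0 1).2
    have h2 := (H3 1 0 0 0 0 0).2
    have h3 := (H3 0 0 0 0 0 1).2
    simp only [T4] at h1 h2 h3
    linear_combination (h1-h2-h3)/2
  · have h1 := (H3 0 1 1 0 0 0).2
    have h2 := (H3 0 1 0 0 0 0).2
    have h3 := (H3 0 0 1 0 0 0).2
    simp only [T4] at h1 h2 h3
    linear_combination (h1-h2-h3)/2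
  · have h1 := (H3 0 1 0 1 0 0).2
    have h2 := (H3 0 1 0 0 0 0).2
    have h3 := (H3 0 0 0 1 0 0).2
    simp only [T4] at h1 h2 h3
    linear_combination (h1-h2-h3)/2
  · have h1 := (H3 0 1 0 0 1 0).2
    have h2 := (H3 0 1 0 0 0 0).2
    have h3 := (H3 0 0 0 0 1 0).2
    simp only [T4] at h1 h2 h3
    linear_combination (h1-h2-h3)/2
  · have h1 := (H3 0 1 0 0 0 1).2
    have h2 := (H3 0 1 0 0 0 0).2
    have h3 := (H3 0 0 0 0 0 1).2
    simp only [T4] at h1 h2 h3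
    linear_combination (h1-h2-h3)/2
  · have h1 := (H3 0 0 1 1 0 0).2
    have h2 := (H3 0 0 1 0 0 0).2
    have h3 := (H3 0 0 0 1 0 0).2
    simp only [T4] at h1 h2 h3
    linear_combination (h1-h2-h3)/2
  · have h1 := (H3 0 0 1 0 1 0).2
    have h2 := (H3 0 0 1 0 0 0).2
    have h3 := (H3 0 0 0 0 1 0).2
    simp only [T4] at h1 h2 h3
    linear_combination (h1-h2-h3)/2
  · have h1 := (H3 0 0 1 0 0 1).2
    have h2 := (H3 0 0 1 0 0 0).2
    have h3 := (H3 0 0 0 0 0 1).2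
    simp only [T4] at h1 h2 h3
    linear_combination (h1-h2-h3)/2
  · have h1 := (H3 0 0 0 1 1 0).2
    have h2 := (H3 0 0 0 1 0 0).2
    have h3 := (H3 0 0 0 0 1 0).2
    simp only [T4] at h1 h2 h3
    linear_combination (h1-h2-h3)/2
  · have h1 := (H3 0 0 0 1 0 1).2
    have h2 := (H3 0 0 0 1 0 0).2
    have h3 := (H3 0 0 0 0 0 1).2
    simp only [T4] at h1 h2 h3
    linear_combination (h1-h2-h3)/2
  · have h1 := (H3 0 0 0 0 1 1).2
    have h2 := (H3 0 0 0 0 1 0).2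
    have h3 := (H3 0 0 0 0 0 1).2
    simp only [T4] at h1 h2 h3
    linear_combination (h1-h2-h3)/2
  · intro y p6 p5 p4 p3 p2 p1 p0 hp h4
    obtain ⟨-, -, h4', h3⟩ := H2 y p6 p5 p4 p3 p2 p1 p0 hp
    have : k * (w y)^2 = 0 := by linarith
    rw [h3, this]; ring


lemma sum0 {d e f : ℝ} (hd : d ≠ 0)
    (h1 : 2*(d*e) = f^2-d^2-e^2) (h2 : 2*(d*f) = e^2-d^2-f^2) :
    d+e+f = 0 := by
  have a1 : (d+e+f)*(d+e-f) = 0 := by linear_combination h1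
  have a2 : (d+e+f)*(d+f-e) = 0 := by linear_combination h2
  by_contra hne
  have b1 := (mul_eq_zero.1 a1).resolve_left hne
  have b2 := (mul_eq_zero.1 a2).resolve_left hne
  apply hd
  linarith

lemma L1 {a b c d e f : ℝ} (h : PP ![a,b,c,d,e,f]) (ha : 0 < a) (hd : 0 < d) (hb : 0 < b)
    (he : e = 0) (hc : 0 ≤ c) (hf : 0 ≤ f) : False := by
  obtain ⟨k, w, H⟩ := h.hh
  subst he
  have hk := H.hk
  have w1 : w 1 = 0 := by
    have h1 := H.qB
    have h2 := (mul_eq_zero.1 H.gB).resolve_left hb.ne'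
    have : k * w 1 ^ 2 = 0 := by linear_combination h1-h2
    simpa [hk] using this
  have hfd : f = d := by
    have h1 := H.qAB
    rw [w1] at h1
    have h2 : (2*a*b)*((d-f)*(d+f)) = 0 := by linear_combination h1
    have h3 : d + f ≠ 0 := by positivity
    have h4 : 2*a*b ≠ 0 := by positivity
    have := ((mul_eq_zero.1 ((mul_eq_zero.1 h2).resolve_left h4)).resolve_right h3)
    linarith
  have hca : c = a := by
    have h1 := H.qBD
    rw [w1] at h1
    have h2 : (2*b*d)*((a-c)*(a+c)) = 0 := by linear_combination h1
    have h3 : a + c ≠ 0 := by positivity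
    have h4 : 2*b*d ≠ 0 := by positivity
    have := ((mul_eq_zero.1 ((mul_eq_zero.1 h2).resolve_left h4)).resolve_right h3)
    linarith
  subst hfd hca
  have hA := (mul_eq_zero.1 H.gA).resolve_left ha.ne'
  have hD := (mul_eq_zero.1 H.gD).resolve_left hd.ne'
  have qA := H.qA
  have qD := H.qD
  have qAD := H.qAD
  rw [hA] at qA
  rw [hD] at qD
  have key : (2*c*f)^2*((b^2-c^2-f^2)^2 - 4*c^2*f^2) = 0 := by
    have : (2*c*f*(b^2+c^2+0^2+f^2-2*c^2-2*f^2))^2 = (0-4*c^2*f^2)*(0-4*f^2*c^2) := by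
      rw [qA, qD, qAD]; ring
    linear_combination this
  have h4 : (2*c*f)^2 ≠ 0 := by positivity
  have key2 : ((b-c-f)*((b-c+f)*(b+c-f)))*(b+c+f) = 0 := by
    linear_combination (mul_eq_zero.1 key).resolve_left h4
  have h5 : b+c+f ≠ 0 := by positivity
  have key3 := (mul_eq_zero.1 key2).resolve_right h5
  have hcub := H.cub
  rcases mul_eq_zero.1 key3 with h1 | h1
  · obtain rfl : b = c+f := by linarith
    have := hcub ![1,0,0,1,0,0] 0 0 0 (-8*c*f*(c+f)) (-5*c^2-5*f^2-14*c*f) (-6*c-6*f) (-2)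
      (fun s => by simp [FF, CM]; ring) rfl
    have : c*f*(c+f) = 0 := by linarith
    have : c*f*(c+f) ≠ 0 := by positivity
    contradiction
  · have := hcub ![1,0,0,-1,0,0] 0 0 0 (8*c*f*(c-f)) (-5*c^2-5*f^2+14*c*f) (-6*c+6*f) (-2)
      (fun s => by
        rcases mul_eq_zero.1 h1 with h1 | h1
        · obtain rfl : b = c-f := by linarith
          simp [FF, CM]; ring
        · obtain rfl : b = f-c := by linarith
          simp [FF, CM]; ring) rfl
    have h6 : c*f*(c-f) = 0 := by linarith
    have h7 : c*f ≠ 0 := by positivity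
    have h8 := (mul_eq_zero.1 h6).resolve_left h7
    rcases mul_eq_zero.1 h1 with h1 | h1 <;> linarith

lemma L2aux {x y d e k p q : ℝ} (hx : 0 < x) (hy : 0 < y) (hd : 0 < d) (he : 0 < e)
    (h1 : 0 - 4*x^2*d^2 = -k*p^2) (h2 : 0 - 4*y^2*e^2 = -k*q^2)
    (h3 : 2*x*y*(d^2+e^2) = -k*p*q) : d = e := by
  have : (2*x*y*(d^2+e^2))^2 = (0 - 4*x^2*d^2)*(0 - 4*y^2*e^2) := by rw [h1, h2, h3]; ring
  have h4 : (2*x*y)^2*((d-e)^2*(d+e)^2) = 0 := by linear_combination this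
  have h5 : (2*x*y)^2 ≠ 0 := by positivity
  have h6 : (d+e)^2 ≠ 0 := by positivity
  have := (mul_eq_zero.1 ((mul_eq_zero.1 h4).resolve_left h5)).resolve_right h6
  have := pow_eq_zero_iff (two_ne_zero) |>.1 this
  linarith

lemma L2 {a b c d e f : ℝ} (h : PP ![a,b,c,d,e,f]) (ha : 0 < a) (hd : 0 < d) (hb : 0 < b)
    (he : 0 < e) (hc : c = 0) (hf : f = 0) : b = a ∧ d = a ∧ e = a := by
  obtain ⟨k, w, H⟩ := h.hh
  subst hc hf
  have hA := (mul_eq_zero.1 H.gA).resolve_left ha.ne'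
  have hD := (mul_eq_zero.1 H.gD).resolve_left hd.ne'
  have hB := (mul_eq_zero.1 H.gB).resolve_left hb.ne'
  have hE := (mul_eq_zero.1 H.gE).resolve_left he.ne'
  have qA := H.qA
  have qD := H.qD
  have qB := H.qB
  have qE := H.qE
  rw [hA] at qA
  rw [hD] at qD
  rw [hB] at qB
  rw [hE] at qE
  have h1 : d = e := L2aux ha hb hd he qA qB (by linear_combination H.qAB)
  have h2 : d = b := L2aux ha he hd hb qA qE (by linear_combination H.qAE)
  have h3 : a = b := L2aux hd he ha hb qD qE (by linear_combination H.qDE)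
  exact ⟨h3.symm, by linarith, by linarith⟩

lemma L3 {a b c d e f : ℝ} (h : PP ![a,b,c,d,e,f]) (ha : 0 < a) (hb : 0 < b) (hc : 0 < c)
    (hd : 0 < d) (he : 0 < e) (hf : 0 < f) : False := by
  obtain ⟨k, w, H⟩ := h.hh
  have hA := (mul_eq_zero.1 H.gA).resolve_left ha.ne'
  have hB := (mul_eq_zero.1 H.gB).resolve_left hb.ne'
  have hC := (mul_eq_zero.1 H.gC).resolve_left hc.ne'
  have hD := (mul_eq_zero.1 H.gD).resolve_left hd.ne'
  have hE := (mul_eq_zero.1 H.gE).resolve_left he.ne'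
  have hF := (mul_eq_zero.1 H.gF).resolve_left hf.ne'
  have qA := H.qA
  have qB := H.qB
  have qC := H.qC
  have qD := H.qD
  have qE := H.qE
  have qF := H.qF
  rw [hA] at qA
  rw [hB] at qB
  rw [hC] at qC
  rw [hD] at qD
  rw [hE] at qE
  rw [hF] at qF
  have hk : 0 < k := by
    by_contra hcon
    have h1 : 0 < 4*a^2*d^2 := by positivity
    have h2 : k * w 0^2 ≤ 0 := mul_nonpos_of_nonpos_of_nonneg (not_lt.1 hcon) (sq_nonneg _)
    linarith
  obtain ⟨r, hr⟩ : ∃ r : ℝ, r^2 = k := ⟨√k, Real.sq_sqrt hk.le⟩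
  have sqr : ∀ (x y p : ℝ), 0 < x → 0 - 4*x^2*y^2 = -k*p^2 → (r*p/(2*x))^2 = y^2 := by
    intro x y p hx h
    rw [div_pow, mul_pow, hr]
    field_simp
    linarith
  have prd : ∀ (x y p q G : ℝ), 0 < x → 0 < y → 2*x*y*G = -k*p*q →
      2*((r*p/(2*x))*(r*q/(2*y))) = -G := by
    intro x y p q G hx hy h
    rw [show 2*((r*p/(2*x))*(r*q/(2*y))) = (r^2*p*q)/(2*x*y) by field_simp, hr]
    field_simp
    linarith
  have nz : ∀ (u y : ℝ), 0 < y → u^2 = y^2 → u ≠ 0 := by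
    rintro u y hy h rfl
    have : 0 < y^2 := by positivity
    norm_num at h
    linarith
  obtain ⟨uD, huD⟩ : ∃ u, u = r*w 0/(2*a) := ⟨_, rfl⟩
  obtain ⟨uE, huE⟩ : ∃ u, u = r*w 1/(2*b) := ⟨_, rfl⟩
  obtain ⟨uF, huF⟩ : ∃ u, u = r*w 2/(2*c) := ⟨_, rfl⟩
  obtain ⟨uA, huA⟩ : ∃ u, u = r*w 3/(2*d) := ⟨_, rfl⟩
  obtain ⟨uB, huB⟩ : ∃ u, u = r*w 4/(2*e) := ⟨_, rfl⟩
  obtain ⟨uC, huC⟩ : ∃ u, u = r*w 5/(2*f) := ⟨_, rfl⟩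
  have sD := sqr a d _ ha qA
  have sE := sqr b e _ hb qB
  have sF := sqr c f _ hc qC
  have sA := sqr d a _ hd qD
  have sB := sqr e b _ he qE
  have sC := sqr f c _ hf qF
  have pAB := prd _ _ _ _ _ ha hb H.qAB
  have pAC := prd _ _ _ _ _ ha hc H.qAC
  have pAD := prd _ _ _ _ _ ha hd H.qAD
  have pAE := prd _ _ _ _ _ ha he H.qAE
  have pAF := prd _ _ _ _ _ ha hf H.qAF
  have pBC := prd _ _ _ _ _ hb hc H.qBC
  have pBD := prd _ _ _ _ _ hb hd H.qBD
  have pBF := prd _ _ _ _ _ hb hf H.qBF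
  have pCD := prd _ _ _ _ _ hc hd H.qCD
  have pCE := prd _ _ _ _ _ hc he H.qCE
  have pDE := prd _ _ _ _ _ hd he H.qDE
  have pDF := prd _ _ _ _ _ hd hf H.qDF
  have pEF := prd _ _ _ _ _ he hf H.qEF
  rw [← huD] at sD pAB pAC pAD pAE pAF
  rw [← huE] at sE pAB pBC pBD pBF
  rw [← huF] at sF pAC pBC pCD pCE
  rw [← huA] at sA pAD pBD pCD pDE pDF
  rw [← huB] at sB pAE pCE pDE pEF
  rw [← huC] at sC pAF pBF pDF pEF
  have nA := nz _ _ ha sA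
  have nB := nz _ _ hb sB
  have nC := nz _ _ hc sC
  have nD := nz _ _ hd sD
  have nE := nz _ _ he sE
  have nF := nz _ _ hf sF
  have f1 : uD + uE + uF = 0 := sum0 nD (by linarith) (by linarith)
  have f2 : uA + uB + uF = 0 := sum0 nA (by linarith) (by linarith)
  have f3 : uA + uE + uC = 0 := sum0 nA (by linarith) (by linarith)
  have f4 : uB + uC + uD = 0 := sum0 nB (by linarith) (by linarith)
  have e1 : uD = uA := by linarith
  have e2 : uE = uB := by linarith
  have e3 : uF = uC := by linarith
  subst e1 e2 e3
  have e4 : uD = -(uE+uF) := by linarith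
  have : uE*uF = 0 := by
    rw [e4] at pAD sA sD
    linarith
  rcases mul_eq_zero.1 this with h | h
  · exact nE h
  · exact nF h

lemma L4 {a b c d e f : ℝ} (h : PP ![a,b,c,d,e,f]) (ha : 0 < a) (hd : 0 < d)
    (hb : b = 0) (hc : c = 0) (he : e = 0) (hf : f = 0) : False := by
  obtain ⟨k, w, H⟩ := h.hh
  subst hb hc he hf
  have hA := (mul_eq_zero.1 H.gA).resolve_left ha.ne'
  have hD := (mul_eq_zero.1 H.gD).resolve_left hd.ne'
  have qA := H.qA
  have qD := H.qD
  have qAD := H.qAD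
  rw [hA] at qA
  rw [hD] at qD
  have key : (2*a*d*(0^2+0^2+0^2+0^2-2*a^2-2*d^2))^2 = (0-4*a^2*d^2)*(0-4*d^2*a^2) := by
    rw [qA, qD, qAD]; ring
  have : (4*a*d)^2*(a^4+a^2*d^2+d^4) = 0 := by linear_combination key
  have : (4*a*d)^2*(a^4+a^2*d^2+d^4) ≠ 0 := by positivity
  contradiction

lemma L5 {a b c d e f : ℝ} (h : PP ![a,b,c,d,e,f]) (ha : 0 < a) (hb : 0 < b) (hf : 0 < f)
    (hc : c = 0) (hd : d = 0) (he : e = 0) : False := by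
  obtain ⟨k, w, H⟩ := h.hh
  subst hc hd he
  have : a*(b^2*f^2) = 0 := by linear_combination -H.gA
  have : a*(b^2*f^2) ≠ 0 := by positivity
  contradiction

lemma L6 {a b c d e f : ℝ} (h : PP ![a,b,c,d,e,f]) (ha : 0 < a) (hb : 0 < b) (hc : 0 ≤ c)
    (hd : d = 0) (he : e = 0) (hf : f = 0) : False := by
  obtain ⟨k, w, H⟩ := h.hh
  subst hd he hf
  have hk := H.hk
  have hcub := H.cub
  have sq0 : ∀ {x y : ℝ}, 0 ≤ x → 0 ≤ y → x^2 - y^2 = 0 → x = y := by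
    intro x y hx hy h
    exact (sq_eq_sq₀ hx hy).1 (by linarith)
  have case1 : b = a → c ≠ a → False := by
    rintro rfl hcb
    have := hcub ![1,0,0,1,0,0] 0 0 0 (2*b*(c^2-b^2)) (-6*b^2+c^2) (-6*b) (-2)
      (fun s => by simp [FF, CM]; ring) rfl
    have : c^2 - b^2 = 0 := by
      have h2 : 2*b ≠ 0 := by positivity
      exact (mul_eq_zero.1 this).resolve_left h2
    exact hcb (sq0 hc hb.le this)
  have case2 : c = a → b ≠ a → False := by
    rintro rfl hcb
    have := hcub ![1,0,0,1,0,0] 0 0 0 (2*c*(b^2-c^2)) (-6*c^2+b^2) (-6*c) (-2)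
      (fun s => by simp [FF, CM]; ring) rfl
    have : b^2 - c^2 = 0 := by
      have h2 : 2*c ≠ 0 := by positivity
      exact (mul_eq_zero.1 this).resolve_left h2
    exact hcb (sq0 hb.le hc this)
  have case3 : c = b → a ≠ b → False := by
    rintro rfl hcb
    have := hcub ![0,1,0,0,1,0] 0 0 0 (2*c*(a^2-c^2)) (-6*c^2+a^2) (-6*c) (-2)
      (fun s => by simp [FF, CM]; ring) rfl
    have : a^2 - c^2 = 0 := by
      have h2 : 2*c ≠ 0 := by positivity
      exact (mul_eq_zero.1 this).resolve_left h2
    exact hcb (sq0 ha.le hc this)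
  have qA : k * w 0^2 = 0 := by linear_combination H.qA
  have qB : k * w 1^2 = 0 := by linear_combination H.qB
  have qC : k * w 2^2 = 0 := by linear_combination H.qC
  have qD : k * w 3^2 = (a^2-b^2)*(a^2-c^2) := by linear_combination H.qD
  have qE : k * w 4^2 = (b^2-a^2)*(b^2-c^2) := by linear_combination H.qE
  have qF : k * w 5^2 = (c^2-a^2)*(c^2-b^2) := by linear_combination H.qF
  have qDE : k * w 3 * w 4 = 0 := by linear_combination H.qDE
  by_cases hab : b = a
  · by_cases hac : c = a
    · subst hab hac
      obtain ⟨i, hi⟩ := H.hw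
      apply hi
      have z : ∀ j, k * w j^2 = 0 → w j = 0 := by
        intro j hj
        simpa [hk] using hj
      fin_cases i
      · exact z _ qA
      · exact z _ qB
      · exact z _ qC
      · exact z _ (qD.trans (by ring))
      · exact z _ (qE.trans (by ring))
      · exact z _ (qF.trans (by ring))
    · exact case1 hab hac
  · by_cases hac : c = a
    · exact case2 hac hab
    · by_cases hbc : c = b
      · exact case3 hbc (Ne.symm hab)
      · have : (k * w 3^2) * (k * w 4^2) = 0 := by
          linear_combination k * w 3 * w 4 * qDE
        rw [qD, qE] at this
        simp only [mul_eq_zero] at this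
        rcases this with (h | h) | (h | h)
        · exact hab (sq0 ha.le hb.le h).symm
        · exact hac (sq0 ha.le hc h).symm
        · exact hab (sq0 hb.le ha.le h)
        · exact hbc (sq0 hb.le hc h).symm

def TT : Fin 24 → Fin 6 → Fin 6 := ![
  ![0,1,2,3,4,5], ![0,2,1,3,5,4], ![1,0,2,4,3,5], ![1,2,0,4,5,3], ![2,0,1,5,3,4], ![2,1,0,5,4,3],
  ![0,5,4,3,2,1], ![0,4,5,3,1,2], ![5,0,4,2,3,1], ![5,4,0,2,1,3], ![4,0,5,1,3,2], ![4,5,0,1,2,3],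
  ![1,5,3,4,2,0], ![1,3,5,4,0,2], ![5,1,3,2,4,0], ![5,3,1,2,0,4], ![3,1,5,0,4,2], ![3,5,1,0,2,4],
  ![2,4,3,5,1,0], ![2,3,4,5,0,1], ![4,2,3,1,5,0], ![4,3,2,1,0,5], ![3,2,4,0,5,1], ![3,4,2,0,1,5]]

lemma TT_bij : ∀ n, Function.Bijective (TT n) := by decide +kernel

lemma TT_sym (x : Fin 6 → ℝ) (n : Fin 24) : FF (x ∘ TT n) = FF x := by
  fin_cases n <;> simp [TT, FF, CM] <;> ring

lemma PP_sym {v : Fin 6 → ℝ} (h : PP v) (n : Fin 24) : PP (v ∘ TT n) := by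
  obtain ⟨k, w, w', hk, hw, H⟩ := h
  let e := Equiv.ofBijective _ (TT_bij n)
  refine ⟨k, w ∘ₗ LinearMap.funLeft ℝ ℝ e.symm, fun y => w' (y ∘ e.symm), hk, ?_, ?_⟩
  · intro h0
    apply hw
    ext1 i
    ext
    have := LinearMap.congr_fun h0 ((Pi.single i 1 : Fin 6 → ℝ) ∘ e)
    have h2 : ((Pi.single i 1 : Fin 6 → ℝ) ∘ e) ∘ e.symm = Pi.single i 1 := by
      funext j; simp
    simp only [LinearMap.comp_apply, LinearMap.funLeft] at this
    simpa [h2] using this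
  · intro y
    obtain ⟨β, γ, hy⟩ := H (y ∘ e.symm)
    refine ⟨β, γ, fun s => ?_⟩
    have h1 : s • (v ∘ TT n) + y = (s • v + y ∘ e.symm) ∘ TT n := by
      funext j
      have : e.symm (TT n j) = j := e.symm_apply_apply j
      simp [this]
    rw [h1, TT_sym, hy]
    rfl

def cls : Fin 9 → Fin 6 → Bool := ![
  ![true,false,false,false,false,false], ![false,true,false,false,false,false],
  ![false,false,true,false,false,false], ![false,false,false,true,false,false],
  ![false,false,false,false,true,false], ![false,false,false,false,false,true],
  ![true,true,false,true,true,false], ![true,false,true,true,false,true],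
  ![false,true,true,false,true,true]]

def bad (S : Fin 6 → Bool) : Bool :=
  (S 0 && S 3 && S 1 && !S 4) || (S 0 && S 1 && S 2 && S 3 && S 4 && S 5)
  || (S 0 && S 3 && !S 1 && !S 2 && !S 4 && !S 5) || (S 0 && S 1 && S 5 && !S 2 && !S 3 && !S 4)
  || (S 0 && S 1 && !S 3 && !S 4 && !S 5)

lemma supp_cases : ∀ s0 s1 s2 s3 s4 s5 : Bool,
    (∃ n, ![s0,s1,s2,s3,s4,s5] = cls n) ∨ (∃ n : Fin 24, bad (![s0,s1,s2,s3,s4,s5] ∘ TT n) = true) ∨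
    (∀ i, ![s0,s1,s2,s3,s4,s5] i = false) := by decide +kernel

lemma cls_cases : ∀ n : Fin 9, (∃ i, ∀ j, cls n j = decide (j = i)) ∨
    (∃ m : Fin 24, ∀ j, cls n (TT m j) = ![true,true,false,true,true,false] j) := by decide +kernel

lemma vec6 {α : Type*} (v : Fin 6 → α) : v = ![v 0, v 1, v 2, v 3, v 4, v 5] := by
  funext i; fin_cases i <;> rfl

open Classical in
lemma col_class (v : Fin 6 → ℝ) (hv : ∀ i, 0 ≤ v i) (h : PP v) :
    ∃ (n : Fin 9) (t : ℝ), 0 < t ∧ ∀ i, v i = if cls n i then t else 0 := by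
  obtain ⟨S, hS⟩ : ∃ S : Fin 6 → Bool, ∀ i, S i = decide (0 < v i) := ⟨_, fun _ => rfl⟩
  have hSt : ∀ i, S i = true → 0 < v i := fun i hi => by simpa [hS] using hi
  have hSf : ∀ i, S i = false → v i = 0 := fun i hi => by
    have : ¬ 0 < v i := by simpa [hS] using hi
    exact le_antisymm (not_lt.1 this) (hv i)
  have hc := supp_cases (S 0) (S 1) (S 2) (S 3) (S 4) (S 5)
  rw [← vec6 S] at hc
  rcases hc with ⟨n, rfl⟩ | ⟨n, hn⟩ | h0
  · refine ⟨n, ?_⟩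
    rcases cls_cases n with ⟨i, hi⟩ | ⟨m, hm⟩
    · refine ⟨v i, hSt i (by simp [hi]), fun j => ?_⟩
      by_cases hj : j = i
      · subst hj; simp [hi]
      · rw [hSf j (by simp [hi, hj])]; simp [hi, hj]
    · have hp := PP_sym h m
      rw [vec6 (v ∘ TT m)] at hp
      have p0 := hSt _ (hm 0)
      have p1 := hSt _ (hm 1)
      have p2 := hSf _ (hm 2)
      have p3 := hSt _ (hm 3)
      have p4 := hSt _ (hm 4)
      have p5 := hSf _ (hm 5)
      obtain ⟨e1, e3, e4⟩ := L2 hp p0 p3 p1 p4 p2 p5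
      simp only [Function.comp] at e1 e3 e4
      refine ⟨v (TT m 0), p0, fun j => ?_⟩
      obtain ⟨i, rfl⟩ := (TT_bij m).2 j
      rw [hm]
      fin_cases i
      · simp
      · simpa using e1
      · simpa using p2
      · simpa using e3
      · simpa using e4
      · simpa using p5
  · exfalso
    have hp := PP_sym h n
    rw [vec6 (v ∘ TT n)] at hp
    simp only [bad, Bool.or_eq_true, Bool.and_eq_true, Bool.not_eq_true', Function.comp] at hn
    have z := fun i => hv (TT n i)
    rcases hn with (((hn | hn) | hn) | hn) | hn
    · obtain ⟨⟨⟨a, b⟩, c⟩, d⟩ := hn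
      exact L1 hp (hSt _ a) (hSt _ b) (hSt _ c) (hSf _ d) (z 2) (z 5)
    · obtain ⟨⟨⟨⟨⟨a, b⟩, c⟩, d⟩, e⟩, f⟩ := hn
      exact L3 hp (hSt _ a) (hSt _ b) (hSt _ c) (hSt _ d) (hSt _ e) (hSt _ f)
    · obtain ⟨⟨⟨⟨⟨a, b⟩, c⟩, d⟩, e⟩, f⟩ := hn
      exact L4 hp (hSt _ a) (hSt _ b) (hSf _ c) (hSf _ d) (hSf _ e) (hSf _ f)
    · obtain ⟨⟨⟨⟨⟨a, b⟩, c⟩, d⟩, e⟩, f⟩ := hn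
      exact L5 hp (hSt _ a) (hSt _ b) (hSt _ c) (hSf _ d) (hSf _ e) (hSf _ f)
    · obtain ⟨⟨⟨⟨a, b⟩, c⟩, d⟩, e⟩ := hn
      exact L6 hp (hSt _ a) (hSt _ b) (z 2) (hSf _ c) (hSf _ d) (hSf _ e)
  · exfalso
    have v0 : v = ![0,0,0,0,0,0] := by
      funext i
      rw [hSf i (h0 i)]
      fin_cases i <;> rfl
    rw [v0] at h
    obtain ⟨k, w, H⟩ := h.hh
    obtain ⟨i, hi⟩ := H.hw
    apply hi
    have z : ∀ j, k * w j^2 = 0 → w j = 0 := by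
      intro j hj
      simpa [H.hk] using hj
    fin_cases i
    · exact z 0 (by linear_combination H.qA)
    · exact z 1 (by linear_combination H.qB)
    · exact z 2 (by linear_combination H.qC)
    · exact z 3 (by linear_combination H.qD)
    · exact z 4 (by linear_combination H.qE)
    · exact z 5 (by linear_combination H.qF)

lemma FFquad (j : Fin 6) (z : Fin 6 → ℝ) : ∃ β γ : ℝ, ∀ s : ℝ,
    FF (s • Pi.single j 1 + z) = -(z (j+3))^2 * (s + z j)^4 + β * (s + z j)^2 + γ := by
  refine ⟨FF (Function.update z j 1) - FF (Function.update z j 0) + (z (j+3))^2,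
    FF (Function.update z j 0), fun s => ?_⟩
  fin_cases j <;> simp [FF, CM, Function.update, Pi.single_apply] <;> ring

lemma cls_pair : ∀ p q : Fin 9, p ≠ q → (∃ k, cls p k = true ∧ cls q k = true) →
    FF (fun i => (if cls p i then (1:ℤ) else 0) + (if cls q i then 1 else 0)) ≠
    FF (fun i => (if cls p i then (1:ℤ) else 0) - (if cls q i then 1 else 0)) := by
  decide +kernel

lemma cls_ne : ∀ p : Fin 9, ∃ k, cls p k = true := by decide

lemma FF_two (p q : Fin 6) (hpq : p ≠ q) (a b : ℝ) :
    FF (Pi.single p a + Pi.single q b) = if q = p + 3 then -(a^2*b^2*(a^2+b^2)) else 0 := by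
  fin_cases p <;> fin_cases q <;>
    first
    | exact absurd rfl hpq
    | (simp [FF, CM, Pi.single_apply] <;> first | done | ring)

lemma FF_smul (l : ℝ) (x : Fin 6 → ℝ) : FF (l • x) = l^6 * FF x := by
  simp [FF, CM]; ring

lemma perm_final : ∀ p0 p1 p2 : Fin 6,
    Function.Injective ![p0, p1, p2, p0+3, p1+3, p2+3] →
    FF (fun i => (if i = p0 then (1:ℤ) else 0) + (if i = p1 then 1 else 0)
      + (if i = p2+3 then 1 else 0)) = -1 →
    ∃ σ : Equiv.Perm (Fin 4), ∀ j,
      (ed (![p0, p1, p2, p0+3, p1+3, p2+3] j)).1 = Sym2.map σ (ed j).1 := by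
  decide +kernel

lemma FF_sq {R : Type*} [CommRing R] {x y : Fin 6 → R} (h : ∀ i, x i ^ 2 = y i ^ 2) :
    FF x = FF y := by
  simp only [FF, h]

lemma col_PP (M : Matrix (Fin 6) (Fin 6) ℝ) (hM : IsUnit M.det) (c : ℝ) (hc : c ≠ 0)
    (h : ∀ x, FF (M.mulVec x) = c * FF x) (j : Fin 6) : PP (fun i => M i j) := by
  have h1 : ∀ y, M.mulVec (M⁻¹.mulVec y) = y := fun y => by
    rw [Matrix.mulVec_mulVec, Matrix.mul_nonsing_inv _ hM, Matrix.one_mulVec]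
  have h2 : ∀ y, M⁻¹.mulVec (M.mulVec y) = y := fun y => by
    rw [Matrix.mulVec_mulVec, Matrix.nonsing_inv_mul _ hM, Matrix.one_mulVec]
  refine ⟨c, (LinearMap.proj (j+3)) ∘ₗ M⁻¹.mulVecLin, fun y => M⁻¹.mulVec y j, hc, ?_, ?_⟩
  · intro h0
    have := LinearMap.congr_fun h0 (M.mulVec (Pi.single (j+3) 1))
    simp only [LinearMap.comp_apply, Matrix.mulVecLin_apply, h2] at this
    simp at this
  · intro y
    obtain ⟨β, γ, H⟩ := FFquad j (M⁻¹.mulVec y)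
    refine ⟨c * β, c * γ, fun s => ?_⟩
    have e : s • (fun i => M i j) + y = M.mulVec (s • Pi.single j 1 + M⁻¹.mulVec y) := by
      rw [Matrix.mulVec_add, h1, Matrix.mulVec_smul, Matrix.mulVec_single_one]
      rfl
    rw [e, h, H]
    simp only [LinearMap.comp_apply, Matrix.mulVecLin_apply, LinearMap.proj_apply]
    ring

lemma mono_form (M : Matrix (Fin 6) (Fin 6) ℝ) (hM : IsUnit M.det) (h0 : ∀ i j, 0 ≤ M i j)
    (c : ℝ) (hc : c ≠ 0) (h : ∀ x, FF (M.mulVec x) = c * FF x) :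
    ∃ (ρ : Fin 6 → Fin 6) (t : Fin 6 → ℝ), Function.Injective ρ ∧ (∀ j, 0 < t j) ∧
      ∀ k j, M k j = if k = ρ j then t j else 0 := by
  choose q t ht hq using fun j => col_class _ (fun i => h0 i j) (col_PP M hM c hc h j)
  have hinj : ∀ y, M.mulVec y = 0 → y = 0 := fun y hy => by
    have := congrArg (M⁻¹.mulVec) hy
    rwa [Matrix.mulVec_mulVec, Matrix.nonsing_inv_mul _ hM, Matrix.one_mulVec,
      Matrix.mulVec_zero] at this
  have mv : ∀ (i j : Fin 6) (a b : ℝ), M.mulVec (Pi.single i (a * (t i)⁻¹) + Pi.single j (b * (t j)⁻¹))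
      = fun k => (if cls (q i) k then a else 0) + (if cls (q j) k then b else 0) := by
    intro i j a b
    rw [Matrix.mulVec_add, Matrix.mulVec_single, Matrix.mulVec_single]
    funext k
    have n1 := (ht i).ne'
    have n2 := (ht j).ne'
    simp only [Pi.add_apply, Pi.smul_apply, Matrix.col_apply, hq, MulOpposite.smul_eq_mul_unop,
      MulOpposite.unop_op]
    split_ifs <;> field_simp <;> ring
  have hqne : ∀ i j, i ≠ j → q i ≠ q j := by
    intro i j hij e
    have := hinj _ (by rw [mv i j 1 (-1), e]; funext k; simp; split_ifs <;> simp)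
    have := congrFun this i
    simp [hij, (ht i).ne'] at this
  have disj : ∀ i j, i ≠ j → ∀ k, cls (q i) k = true → cls (q j) k = true → False := by
    intro i j hij k hi hj
    apply cls_pair (q i) (q j) (hqne i j hij) ⟨k, hi, hj⟩
    have e1 := mv i j 1 1
    have e2 := mv i j 1 (-1)
    have e3 : FF (M.mulVec (Pi.single i (1 * (t i)⁻¹) + Pi.single j (1 * (t j)⁻¹))) =
        FF (M.mulVec (Pi.single i (1 * (t i)⁻¹) + Pi.single j (-1 * (t j)⁻¹))) := by
      rw [h, h]
      congr 1
      apply FF_sq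
      intro k
      by_cases ki : k = i
      · subst ki; simp [hij]
      · by_cases kj : k = j
        · subst kj; simp [ki]
        · simp [ki, kj]
    rw [e1, e2] at e3
    have inj : Function.Injective (Int.castRingHom ℝ) := Int.cast_injective
    apply inj
    rw [FF_map, FF_map]
    convert e3 using 2
    · funext k; simp
    · funext k; simp; split_ifs <;> simp
  choose ρ hρ using fun j => cls_ne (q j)
  have ρinj : Function.Injective ρ := by
    intro i j hij
    by_contra hne
    exact disj i j hne (ρ i) (hρ i) (hij ▸ hρ j)
  have ρsurj : Function.Surjective ρ := Finite.surjective_of_injective ρinj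
  refine ⟨ρ, t, ρinj, ht, fun k j => ?_⟩
  rw [hq j k]
  by_cases hk : k = ρ j
  · subst hk; simp [hρ]
  · rw [if_neg hk, if_neg]
    intro hkj
    obtain ⟨i, rfl⟩ := ρsurj k
    have : i ≠ j := fun e => hk (by rw [e])
    exact disj i j this _ (hρ i) hkj

lemma real_main (M : Matrix (Fin 6) (Fin 6) ℝ) (hM : IsUnit M.det) (h0 : ∀ i j, 0 ≤ M i j)
    (c : ℝ) (hc : c ≠ 0) (h : ∀ x, FF (M.mulVec x) = c * FF x) :
    ∃ (σ : Equiv.Perm (Fin 4)) (l : ℝ), 0 < l ∧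
      ∀ k j, M k j = if (ed k).1 = Sym2.map σ (ed j).1 then l else 0 := by
  obtain ⟨ρ, t, ρinj, ht, hf⟩ := mono_form M hM h0 c hc h
  have col : ∀ i (a : ℝ), M.mulVec (Pi.single i a) = Pi.single (ρ i) (t i * a) := by
    intro i a
    rw [Matrix.mulVec_single]
    funext k
    simp [hf, Pi.single_apply]
  have hne : ∀ i : Fin 6, i ≠ i + 3 := by decide
  have two : ∀ i (b : ℝ), (if ρ (i+3) = ρ i + 3 then
      -((t i)^2*(t (i+3)*b)^2*((t i)^2+(t (i+3)*b)^2)) else 0) = c * (-(b^2*(1+b^2))) := by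
    intro i b
    have := h (Pi.single i 1 + Pi.single (i+3) b)
    rw [Matrix.mulVec_add, col, col, FF_two _ _ (fun e => hne i (ρinj e)), FF_two _ _ (hne i)] at this
    simpa using this
  have h3 : ∀ i, ρ (i+3) = ρ i + 3 := by
    intro i
    by_contra hn
    have := two i 1
    rw [if_neg hn] at this
    apply hc
    linarith
  have e1 : ∀ i, t (i+3)^2 = t i^2 ∧ c = t i ^ 6 := by
    intro i
    have a1 := two i 1
    have a2 := two i 2
    rw [if_pos (h3 i)] at a1 a2
    have x : 0 < t i^2 := by have := ht i; positivity
    have y : 0 < t (i+3)^2 := by have := ht (i+3); positivity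
    have e : t (i+3)^2 = t i^2 := by
      have : t i^2 * t (i+3)^2 * (6 * (t (i+3)^2 - t i^2)) = 0 := by
        linear_combination -a2 + 10 * a1
      have := (mul_eq_zero.1 this).resolve_left (by positivity)
      linarith
    refine ⟨e, ?_⟩
    have : t i^2 * t (i+3)^2 * (t i^2 + t (i+3)^2) = 2 * c := by linear_combination -a1
    rw [e] at this
    linear_combination -this/2
  have ht' : ∀ i, t i = t 0 := by
    intro i
    have : t i^6 = t 0^6 := by rw [← (e1 i).2, ← (e1 0).2]
    exact (pow_left_inj₀ (ht i).le (ht 0).le (by norm_num)).1 this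
  have hl := ht 0
  generalize t 0 = l at ht' hl
  have hcl : c = l^6 := by rw [(e1 0).2, ht']
  have r3 : ρ 3 = ρ 0 + 3 := h3 0
  have r4 : ρ 4 = ρ 1 + 3 := h3 1
  have r5 : ρ 5 = ρ 2 + 3 := h3 2
  have hρ : ![ρ 0, ρ 1, ρ 2, ρ 0 + 3, ρ 1 + 3, ρ 2 + 3] = ρ := by
    rw [← r3, ← r4, ← r5]; exact (vec6 ρ).symm
  have hF := h (Pi.single 0 1 + Pi.single 1 1 + Pi.single 5 1)
  rw [Matrix.mulVec_add, Matrix.mulVec_add, col, col, col] at hF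
  have hs : ∀ i : Fin 6, (Pi.single (ρ i) (t i * 1) : Fin 6 → ℝ) = l • Pi.single (ρ i) 1 := by
    intro i
    rw [ht', ← Pi.single_smul]; simp
  rw [hs, hs, hs, ← smul_add, ← smul_add, FF_smul, hcl] at hF
  have hv : FF (Pi.single 0 1 + Pi.single 1 1 + Pi.single 5 1 : Fin 6 → ℝ) = -1 := by
    simp [FF, CM]
  rw [hv] at hF
  have hF' := mul_left_cancel₀ (by positivity) hF
  obtain ⟨σ, hσ⟩ := perm_final (ρ 0) (ρ 1) (ρ 2) (by rw [hρ]; exact ρinj) (by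
    have inj : Function.Injective (Int.castRingHom ℝ) := Int.cast_injective
    apply inj
    rw [FF_map]
    rw [r5] at hF'
    simp only [map_neg, map_one]
    rw [← hF']
    congr 1
    funext k
    simp [Pi.single_apply])
  rw [hρ] at hσ
  refine ⟨σ, l, hl, fun k j => ?_⟩
  rw [hf, ← hσ, ht']
  congr 1
  rw [← Subtype.ext_iff]
  exact propext ⟨fun e => by rw [e], fun e => ed_bij.1 e⟩

def edMap (σ : Equiv.Perm (Fin 4)) (f : Edge 4) : Edge 4 :=
  ⟨Sym2.map σ f.1, by rw [Sym2.isDiag_map σ.injective]; exact f.2⟩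

lemma edMap_edMap (σ τ : Equiv.Perm (Fin 4)) (f : Edge 4) : edMap σ (edMap τ f) = edMap (σ * τ) f := by
  apply Subtype.ext
  simp [edMap, Sym2.map_map]

lemma edMap_one (f : Edge 4) : edMap 1 f = f := by
  apply Subtype.ext
  simp [edMap]

lemma edMap_inj (σ : Equiv.Perm (Fin 4)) : Function.Injective (edMap σ) := by
  intro f g h
  have := congrArg (edMap σ⁻¹) h
  simpa [edMap_edMap, edMap_one] using this

lemma relabel_apply (σ : Equiv.Perm (Fin 4)) (c : ℝ) (e f : Edge 4) :
    relabelMat σ c e f = if e = edMap σ f then (c : ℂ) else 0 := by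
  simp only [relabelMat, Matrix.of_apply, Subtype.ext_iff, edMap]

lemma relabel_mulVec (σ : Equiv.Perm (Fin 4)) (c : ℝ) (x : Edge 4 → ℂ) (e : Edge 4) :
    (relabelMat σ c).mulVec x e = c * x (edMap σ⁻¹ e) := by
  have : e = edMap σ (edMap σ⁻¹ e) := by simp [edMap_edMap, edMap_one]
  rw [Matrix.mulVec, dotProduct, Finset.sum_eq_single (edMap σ⁻¹ e)]
  · rw [relabel_apply, if_pos this]
  · intro b _ hb
    rw [relabel_apply, if_neg, zero_mul]
    intro h
    apply hb
    rw [h]; simp [edMap_edMap, edMap_one]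
  · simp

lemma relabel_mem (σ : Equiv.Perm (Fin 4)) (c : ℝ) (x : Edge 4 → ℂ) (hx : x ∈ Lvar 2 4) :
    (relabelMat σ c).mulVec x ∈ Lvar 2 4 := by
  obtain ⟨p, hp⟩ := hx
  refine ⟨fun i k => c * p (σ⁻¹ i) k, fun e => ?_⟩
  have := hp (edMap σ⁻¹ e)
  simp only [sqMap] at this ⊢
  rw [relabel_mulVec, mul_pow, this]
  obtain ⟨e, he⟩ := e
  induction e using Sym2.ind with
  | _ a b =>
    simp only [edMap, Sym2.map_mk, cSqLen, Sym2.lift_mk, Finset.mul_sum]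
    refine Finset.sum_congr rfl fun k _ => ?_
    ring

lemma relabel_inv (σ : Equiv.Perm (Fin 4)) (c : ℝ) (hc : 0 < c) (x : Edge 4 → ℂ) :
    (relabelMat σ c).mulVec ((relabelMat σ⁻¹ c⁻¹).mulVec x) = x := by
  funext e
  rw [relabel_mulVec, relabel_mulVec]
  have : (c : ℂ) ≠ 0 := by exact_mod_cast hc.ne'
  simp [edMap_edMap, edMap_one, this]

lemma part2 (σ : Equiv.Perm (Fin 4)) (c : ℝ) (hc : 0 < c) :
    IsUnit (relabelMat σ c).det ∧
      (fun x => (relabelMat σ c).mulVec x) '' Lvar 2 4 = Lvar 2 4 := by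
  constructor
  · rw [← Matrix.isUnit_iff_isUnit_det, ← Matrix.mulVec_surjective_iff_isUnit]
    exact fun x => ⟨_, relabel_inv σ c hc x⟩
  · apply Set.Subset.antisymm
    · rintro _ ⟨x, hx, rfl⟩
      exact relabel_mem σ c x hx
    · intro x hx
      exact ⟨_, relabel_mem σ⁻¹ c⁻¹ x hx, relabel_inv σ c hc x⟩

lemma part3 (σ σ' : Equiv.Perm (Fin 4)) (c c' : ℝ) (hc : 0 < c)
    (h : relabelMat σ c = relabelMat σ' c') : σ = σ' ∧ c = c' := by
  have key : ∀ f, edMap σ f = edMap σ' f ∧ c = c' := by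
    intro f
    have := congrFun (congrFun h (edMap σ f)) f
    rw [relabel_apply, relabel_apply, if_pos rfl] at this
    split_ifs at this with h1
    · exact ⟨h1, by exact_mod_cast this⟩
    · exact absurd this (by exact_mod_cast hc.ne')
  refine ⟨?_, (key (ed 0)).2⟩
  have : σ'⁻¹ * σ = 1 := by
    apply perm_edge
    intro f
    have h1 : edMap (σ'⁻¹ * σ) f = f := by
      rw [← edMap_edMap, (key f).1, edMap_edMap]; simp [edMap_one]
    exact congrArg Subtype.val h1
  exact (inv_mul_eq_one.1 this).symm

lemma part1 (A : Matrix (Edge 4) (Edge 4) ℂ) (hA : IsUnit A.det)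
    (hL : (fun x => A.mulVec x) '' Lvar 2 4 = Lvar 2 4)
    (hp : ∀ e f, ∃ t : ℝ, 0 ≤ t ∧ A e f = (t : ℂ)) :
    ∃ (σ : Equiv.Perm (Fin 4)) (c : ℝ), 0 < c ∧ A = relabelMat σ c := by
  choose B hB hAB using hp
  let ε : Fin 6 ≃ Edge 4 := Equiv.ofBijective ed ed_bij
  have hε : ∀ i, ε i = ed i := fun i => rfl
  let M : Matrix (Fin 6) (Fin 6) ℝ := Matrix.of fun i j => B (ed i) (ed j)
  have hM' : A.submatrix ε ε = M.map Complex.ofRealHom := by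
    ext i j
    simp [M, hAB, hε]
  have hdet : (A.submatrix ε ε).det = A.det := Matrix.det_submatrix_equiv_self ε A
  have hMdet : IsUnit M.det := by
    have e : (M.map Complex.ofRealHom).det = Complex.ofRealHom M.det :=
      (RingHom.map_det Complex.ofRealHom M).symm
    rw [← hM', hdet] at e
    rw [isUnit_iff_ne_zero] at hA ⊢
    intro h0
    rw [h0, map_zero] at e
    exact hA e
  have mv : ∀ x : Fin 6 → ℂ, ∀ i,
      (M.map Complex.ofRealHom).mulVec x i = A.mulVec (x ∘ ε.symm) (ed i) := by
    intro x i
    rw [← hM', Matrix.submatrix_mulVec_equiv]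
    rfl
  obtain ⟨c, hc⟩ := prop_of_zero (M.map Complex.ofRealHom) (by
    intro x hx
    have h1 : x ∘ ε.symm ∈ Lvar 2 4 := by
      rw [mem_Lvar_iff]
      have : (fun i => (x ∘ ε.symm) (ed i)) = x := by
        funext i; simp [← hε]
      rw [this, hx]
    have h2 : A.mulVec (x ∘ ε.symm) ∈ Lvar 2 4 := by
      rw [← hL]; exact ⟨_, h1, rfl⟩
    rw [mem_Lvar_iff] at h2
    rw [← h2]
    congr 1
    funext i
    exact mv x i)
  have hre : ∀ x : Fin 6 → ℝ, ((FF (M.mulVec x) : ℝ) : ℂ) = c * ((FF x : ℝ) : ℂ) := by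
    intro x
    have a := FF_map Complex.ofRealHom (M.mulVec x)
    have b := FF_map Complex.ofRealHom x
    have d := hc (fun i => Complex.ofRealHom (x i))
    rw [← b] at d
    rw [← Complex.ofRealHom_eq_coe, a, ← Complex.ofRealHom_eq_coe, ← d]
    congr 1
    funext i
    exact RingHom.map_mulVec Complex.ofRealHom M x i
  let x0 : Fin 6 → ℝ := ![1,0,0,1,0,0]
  have hx0 : FF x0 = -2 := by simp [x0, FF, CM]; norm_num
  obtain ⟨r, hr⟩ : ∃ r : ℝ, c = r := by
    refine ⟨-(FF (M.mulVec x0))/2, ?_⟩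
    have := hre x0
    rw [hx0] at this
    push_cast at this ⊢
    linear_combination this/2
  have hreal : ∀ x, FF (M.mulVec x) = r * FF x := by
    intro x
    have := hre x
    rw [hr] at this
    exact_mod_cast this
  have hr0 : r ≠ 0 := by
    rintro rfl
    have := hreal (M⁻¹.mulVec x0)
    rw [Matrix.mulVec_mulVec, Matrix.mul_nonsing_inv _ hMdet, Matrix.one_mulVec, hx0] at this
    norm_num at this
  obtain ⟨σ, l, hl, H⟩ := real_main M hMdet (fun i j => hB _ _) r hr0 hreal
  refine ⟨σ, l, hl, ?_⟩
  ext e f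
  obtain ⟨i, rfl⟩ := ed_bij.2 e
  obtain ⟨j, rfl⟩ := ed_bij.2 f
  have := H i j
  simp only [M, Matrix.of_apply] at this
  rw [hAB, this]
  simp only [relabelMat, Matrix.of_apply]
  split_ifs <;> simp


/-- Every linear automorphism of `L_{2,4}` whose `6 × 6`
matrix has only real non-negative entries is a positive scalar multiple of the
edge permutation matrix induced by a vertex relabeling of `K_4`.  Conversely,
every positive scalar multiple of such an edge permutation matrix is a
non-negative linear automorphism of `L_{2,4}`, and distinct pairs (relabeling,
positive scale) give distinct matrices; hence, up to positive scale, the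
non-negative linear automorphisms are exactly the `24` vertex relabelings of
`K_4`, and they form a subgroup acting by relabeling the vertices. -/
theorem nonnegative_automorphisms_of_L24_are_vertex_relabelings :
    (∀ A : Matrix (Edge 4) (Edge 4) ℂ,
      IsUnit A.det →
      (fun x => A.mulVec x) '' Lvar 2 4 = Lvar 2 4 →
      (∀ e f, ∃ t : ℝ, 0 ≤ t ∧ A e f = (t : ℂ)) →
      ∃ (σ : Equiv.Perm (Fin 4)) (c : ℝ), 0 < c ∧ A = relabelMat σ c) ∧
    (∀ (σ : Equiv.Perm (Fin 4)) (c : ℝ), 0 < c →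
      IsUnit (relabelMat σ c).det ∧
      (fun x => (relabelMat σ c).mulVec x) '' Lvar 2 4 = Lvar 2 4) ∧
    (∀ (σ σ' : Equiv.Perm (Fin 4)) (c c' : ℝ), 0 < c → 0 < c' →
      relabelMat σ c = relabelMat σ' c' → σ = σ' ∧ c = c') := by
  exact ⟨part1, part2, fun σ σ' c c' hc _ h => part3 σ σ' c c' hc h⟩
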